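/- For every real number N > 1 the following holds. Let X_1 and X_2 be independent random variables with P(X_1 = 1) = N/(N+1), P(X_1 = 2N²) = 1/(N+1), P(X_2 = 1/(2N−1)) = (2N−1)/(2N), and P(X_2 = 2N²−1) = 1/(2N). Then: (a) E[min(X_1, X_2)] = 1; and (b) on a probability space carrying X_1, X_2 and an additional independent uniform random variable, there exists a measurable selection rule S with values in the subsets of {1,2} such that P(1 ∈ S) + P(2 ∈ S) = 1 (so the marginal vector of S lies in the convex hull of the indicator vectors of the nonempty subsets of {1,2}, i.e., S is ex ante feasible for the upward-closed constraint of selecting at least one element) and E[ Σ_{i∈S} X_i ] = 1/N. Consequently, the ratio between the ex post minimum E[min(X_1,X_2)] and the cost of the best ex ante feasible selection is at least N, so the correlation gap for minimization is unbounded even for two elements under the single-selection constraint. (This is the Bayesian-selection content of the paper's theorem that the commitment gap of minimization Costly Information Combinatorial Selection can be infinite.) -/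

import Mathlib

open Finset MeasureTheory ProbabilityTheory

/-- A random variable whose values `a ≠ b` carry total mass `1` a.s. takes one of these values. -/
theorem ae_eq_or_eq_of_toReal_add_eq_one {Ω : Type*} [MeasurableSpace Ω] {μ : Measure Ω}
    [IsProbabilityMeasure μ] {X : Ω → ℝ} (hX : Measurable X) {a b : ℝ} (hab : a ≠ b)
    (h : (μ {ω | X ω = a}).toReal + (μ {ω | X ω = b}).toReal = 1) :
    ∀ᵐ ω ∂μ, X ω = a ∨ X ω = b := by
  have hdisj : Disjoint {ω | X ω = a} {ω | X ω = b} :=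
    Set.disjoint_left.2 fun ω h₁ h₂ => hab (h₁.symm.trans h₂)
  have hma : MeasurableSet {ω | X ω = a} := hX (measurableSet_singleton a)
  have hmb : MeasurableSet {ω | X ω = b} := hX (measurableSet_singleton b)
  have hunion : μ ({ω | X ω = a} ∪ {ω | X ω = b}) = 1 := by
    rw [measure_union hdisj hmb, ← ENNReal.toReal_eq_one_iff,
      ENNReal.toReal_add (measure_ne_top _ _) (measure_ne_top _ _), h]
  exact (mem_ae_iff_prob_eq_one (hma.union hmb)).2 hunion

/-- The correlation gap for minimization is unbounded even for two elements under the
single-selection (select at least one element) constraint: the ex post minimum has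
expectation `1`, while an ex ante feasible selection rule achieves cost `1/N`. -/
theorem stmt7 (N : ℝ) (hN : 1 < N)
    {Ω : Type*} [MeasurableSpace Ω] (μ : Measure Ω) [IsProbabilityMeasure μ]
    (X1 X2 U : Ω → ℝ)
    (hX1meas : Measurable X1) (hX2meas : Measurable X2) (hUmeas : Measurable U)
    (hindep : IndepFun X1 X2 μ)
    (hindepU : IndepFun (fun ω => (X1 ω, X2 ω)) U μ)
    (hUunif : μ.map U = MeasureTheory.volume.restrict (Set.Icc (0 : ℝ) 1))
    (hX1a : (μ {ω | X1 ω = 1}).toReal = N / (N + 1))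
    (hX1b : (μ {ω | X1 ω = 2 * N ^ 2}).toReal = 1 / (N + 1))
    (hX2a : (μ {ω | X2 ω = 1 / (2 * N - 1)}).toReal = (2 * N - 1) / (2 * N))
    (hX2b : (μ {ω | X2 ω = 2 * N ^ 2 - 1}).toReal = 1 / (2 * N)) :
    -- (a) the ex post minimum has expected cost 1
    (∫ ω, min (X1 ω) (X2 ω) ∂μ) = 1 ∧
    -- (b) there is an ex ante feasible selection rule of expected cost 1/N
    ∃ S : Ω → Finset (Fin 2),
      (∀ i, MeasurableSet {ω | i ∈ S ω}) ∧
      (μ {ω | 0 ∈ S ω}).toReal + (μ {ω | 1 ∈ S ω}).toReal = 1 ∧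
      (∫ ω, ∑ i ∈ S ω, (if i = 0 then X1 ω else X2 ω) ∂μ) = 1 / N := by
  have hN0 : N ≠ 0 := by positivity
  have hN1 : N + 1 ≠ 0 := by positivity
  have hN2 : 2 * N - 1 ≠ 0 := by linarith
  have hN3 : 1 < 2 * N ^ 2 - 1 := by nlinarith
  have hN4 : 1 / (2 * N - 1) < 1 := by
    rw [div_lt_one (by linarith)]; linarith
  have mX1 : ∀ a, MeasurableSet {ω | X1 ω = a} := fun a => hX1meas (measurableSet_singleton a)
  have mX2 : ∀ a, MeasurableSet {ω | X2 ω = a} := fun a => hX2meas (measurableSet_singleton a)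
  have intInd : ∀ (s : Set Ω) (c : ℝ), MeasurableSet s →
      Integrable (s.indicator fun _ => c) μ := fun s c hs => (integrable_const c).indicator hs
  constructor
  · have ae1 := ae_eq_or_eq_of_toReal_add_eq_one (μ := μ) hX1meas
      (a := 1) (b := 2 * N ^ 2) (by linarith) (by rw [hX1a, hX1b]; field_simp)
    have ae2 := ae_eq_or_eq_of_toReal_add_eq_one (μ := μ) hX2meas
      (a := 1 / (2 * N - 1)) (b := 2 * N ^ 2 - 1) (by linarith)
      (by rw [hX2a, hX2b]; field_simp; ring)
    have hprod : ∀ a b, μ.real ({ω | X1 ω = a} ∩ {ω | X2 ω = b}) =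
        (μ {ω | X1 ω = a}).toReal * (μ {ω | X2 ω = b}).toReal := fun a b => by
      rw [← ENNReal.toReal_mul, Measure.real]
      exact congrArg _ (hindep.measure_inter_preimage_eq_mul _ _
        (measurableSet_singleton a) (measurableSet_singleton b))
    have hmin : (fun ω => min (X1 ω) (X2 ω)) =ᵐ[μ] fun ω =>
        {ω | X2 ω = 1 / (2 * N - 1)}.indicator (fun _ => 1 / (2 * N - 1)) ω +
        (({ω | X1 ω = 1} ∩ {ω | X2 ω = 2 * N ^ 2 - 1}).indicator (fun _ => (1 : ℝ)) ω +
        ({ω | X1 ω = 2 * N ^ 2} ∩ {ω | X2 ω = 2 * N ^ 2 - 1}).indicator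
          (fun _ => 2 * N ^ 2 - 1) ω) := by
      have n1 : (1 : ℝ) ≠ 2 * N ^ 2 := by linarith
      have n2 : 1 / (2 * N - 1) ≠ 2 * N ^ 2 - 1 := by linarith
      filter_upwards [ae1, ae2] with ω h1 h2
      simp only [Set.indicator, Set.mem_inter_iff, Set.mem_ofPred_eq]
      rcases h1 with h1 | h1 <;> rcases h2 with h2 | h2 <;> rw [h1, h2]
      · rw [min_eq_right hN4.le]; simp only [n1, n2]; simp
      · rw [min_eq_left hN3.le]; simp only [n1, n2.symm]; simp
      · rw [min_eq_right (by linarith)]; simp only [n1.symm, n2]; simp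
      · rw [min_eq_right (by linarith)]; simp only [n1.symm, n2.symm]; simp
    have i1 := intInd _ (1 / (2 * N - 1)) (mX2 (1 / (2 * N - 1)))
    have i2 := intInd _ 1 ((mX1 1).inter (mX2 (2 * N ^ 2 - 1)))
    have i3 := intInd _ (2 * N ^ 2 - 1) ((mX1 (2 * N ^ 2)).inter (mX2 (2 * N ^ 2 - 1)))
    rw [integral_congr_ae hmin, integral_add i1 (by exact i2.add i3), integral_add i2 i3,
      integral_indicator_const _ (mX2 _), integral_indicator_const _ ((mX1 _).inter (mX2 _)),
      integral_indicator_const _ ((mX1 _).inter (mX2 _)), hprod, hprod, hX1a, hX1b, hX2b,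
      Measure.real, hX2a]
    simp only [smul_eq_mul]
    field_simp
    ring
  · classical
    set q : ℝ := (N + 1) / (2 * N ^ 2) with hq
    have hq0 : 0 ≤ q := by positivity
    have hq1 : q ≤ 1 := by
      rw [hq, div_le_one (by positivity)]; nlinarith
    have hU : (μ (U ⁻¹' Set.Iic q)).toReal = q := by
      rw [← Measure.map_apply hUmeas measurableSet_Iic, hUunif,
        Measure.restrict_apply measurableSet_Iic]
      have : Set.Iic q ∩ Set.Icc 0 1 = Set.Icc 0 q := by
        ext x
        simp only [Set.mem_inter_iff, Set.mem_Iic, Set.mem_Icc]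
        constructor
        · rintro ⟨h, h', -⟩; exact ⟨h', h⟩
        · rintro ⟨h, h'⟩; exact ⟨h', h, h'.trans hq1⟩
      rw [this, Real.volume_Icc, sub_zero, ENNReal.toReal_ofReal hq0]
    set E : Set Ω := {ω | X1 ω = 1} ∩ U ⁻¹' Set.Iic q with hE
    set B : Set Ω := {ω | X2 ω = 1 / (2 * N - 1)} with hB
    have mE : MeasurableSet E := (mX1 1).inter (hUmeas measurableSet_Iic)
    have mB : MeasurableSet B := mX2 _
    have hEμ : (μ E).toReal = 1 / (2 * N) := by
      have hind : IndepFun X1 U μ := hindepU.comp measurable_fst measurable_id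
      have : μ E = μ {ω | X1 ω = 1} * μ (U ⁻¹' Set.Iic q) :=
        hind.measure_inter_preimage_eq_mul _ _ (measurableSet_singleton 1) measurableSet_Iic
      rw [this, ENNReal.toReal_mul, hX1a, hU, hq]
      field_simp
    let S : Ω → Finset (Fin 2) := fun ω =>
      Finset.univ.filter fun i => if i = 0 then ω ∈ E else ω ∈ B
    have hS0 : {ω | 0 ∈ S ω} = E := by ext ω; simp [S]
    have hS1 : {ω | 1 ∈ S ω} = B := by ext ω; simp [S]
    refine ⟨S, ?_, ?_, ?_⟩
    · rw [Fin.forall_fin_two, hS0, hS1]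
      exact ⟨mE, mB⟩
    · rw [hS0, hS1, hEμ, hX2a]
      field_simp
      ring
    · have hsum : (fun ω => ∑ i ∈ S ω, (if i = 0 then X1 ω else X2 ω)) = fun ω =>
          E.indicator (fun _ => (1 : ℝ)) ω + B.indicator (fun _ => 1 / (2 * N - 1)) ω := by
        funext ω
        simp only [S, Finset.sum_filter, Fin.sum_univ_two, Set.indicator]
        congr 1
        · by_cases h : ω ∈ E
          · simpa [h] using h.1
          · simp [h]
        · by_cases h : ω ∈ B
          · have hX : X2 ω = 1 / (2 * N - 1) := h
            simp [h, hX]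
          · simp [h]
      rw [hsum, integral_add (intInd _ _ mE) (intInd _ _ mB), integral_indicator_const _ mE,
        integral_indicator_const _ mB, Measure.real, Measure.real, hEμ, hX2a]
      simp only [smul_eq_mul]
      field_simp
      ring
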